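/- For every α ∈ (0,1) there exist a compact set E ⊂ ℝ, a Borel probability measure μ on ℝ with μ(E) = 1, and constants 0 < c ≤ C < ∞ such that: (i) |μ̂(ξ)| ≤ C·|ξ|^{−α/2}·(log|ξ|)^{1/2} for every ξ ∈ ℝ with |ξ| ≥ 2; and (ii) for every x ∈ E and every r ∈ (0, 1/2), c·(2r)^α ≤ μ([x−r, x+r]) ≤ C·(2r)^α. -/

import Mathlib

open MeasureTheory

noncomputable section
namespace SalemAux

/-- the character `e(t) = exp(-2πit)` -/
def e (t : ℝ) : ℂ := Complex.exp (Complex.I * ((-(2 * Real.pi * t) : ℝ) : ℂ))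

lemma e_add (s t : ℝ) : e (s + t) = e s * e t := by
  unfold e; rw [← Complex.exp_add]; congr 1; push_cast; ring

lemma norm_e (t : ℝ) : ‖e t‖ = 1 := by
  unfold e; rw [mul_comm]; exact Complex.norm_exp_ofReal_mul_I _

lemma e_zero : e 0 = 1 := by simp [e]

lemma e_int (n : ℤ) : e n = 1 := by
  unfold e
  rw [Complex.exp_eq_one_iff]
  exact ⟨-n, by push_cast; ring⟩

lemma e_sub_one (t : ℝ) : ‖e t - 1‖ ≤ 2 * Real.pi * |t| := by
  unfold e
  refine Real.norm_exp_I_mul_ofReal_sub_one_le.trans ?_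
  rw [Real.norm_eq_abs, abs_neg, abs_mul, abs_of_pos Real.two_pi_pos]

lemma e_sub (s t : ℝ) : ‖e s - e t‖ ≤ 2 * Real.pi * |s - t| := by
  have : e s - e t = e t * (e (s - t) - 1) := by
    rw [mul_sub, ← e_add]; simp
  rw [this, norm_mul, norm_e, one_mul]
  exact e_sub_one _

/-- signs -/
def sg (b : Bool) : ℝ := if b then -1 else 1

lemma sg_abs (b : Bool) : |sg b| = 1 := by cases b <;> simp [sg]

lemma potential {ι : Type*} (T : Finset ι) (a : ι → ℕ → ℝ) (ha : ∀ t x, |a t x| ≤ 1) (l : ℝ)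
    (S : Finset ℕ) : ∃ g : ℕ → Bool,
      ∑ t ∈ T, Real.cosh (l * ∑ x ∈ S, sg (g x) * a t x) ≤
        T.card * Real.exp (l ^ 2 / 2 * S.card) := by
  classical
  induction S using Finset.induction_on with
  | empty => exact ⟨fun _ => true, by simp⟩
  | insert y S hy ih =>
    obtain ⟨g, hg⟩ := ih
    have key : ∀ b : Bool, ∀ t, ∑ x ∈ insert y S, sg (Function.update g y b x) * a t x
        = sg b * a t y + ∑ x ∈ S, sg (g x) * a t x := by
      intro b t
      rw [Finset.sum_insert hy]
      congr 1
      · simp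
      · refine Finset.sum_congr rfl fun x hx => ?_
        rw [Function.update_of_ne]
        rintro rfl; exact hy hx
    have hsum : ∑ t ∈ T, Real.cosh (l * ∑ x ∈ insert y S, sg (Function.update g y true x) * a t x)
        + ∑ t ∈ T, Real.cosh (l * ∑ x ∈ insert y S, sg (Function.update g y false x) * a t x)
        ≤ 2 * (T.card * Real.exp (l ^ 2 / 2 * (insert y S).card)) := by
      simp_rw [key]
      rw [← Finset.sum_add_distrib]
      have h1 : ∀ t ∈ T, Real.cosh (l * (sg true * a t y + ∑ x ∈ S, sg (g x) * a t x)) +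
          Real.cosh (l * (sg false * a t y + ∑ x ∈ S, sg (g x) * a t x)) ≤
          2 * Real.exp (l ^ 2 / 2) * Real.cosh (l * ∑ x ∈ S, sg (g x) * a t x) := by
        intro t _
        set A := ∑ x ∈ S, sg (g x) * a t x
        have e1 : l * (sg true * a t y + A) = l * A - l * a t y := by simp [sg]; ring
        have e2 : l * (sg false * a t y + A) = l * A + l * a t y := by simp [sg]; ring
        rw [e1, e2, Real.cosh_sub, Real.cosh_add]
        have h2 : Real.cosh (l * a t y) ≤ Real.exp (l ^ 2 / 2) := by
          refine (Real.cosh_le_exp_half_sq _).trans (Real.exp_le_exp.2 ?_)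
          have : (a t y) ^ 2 ≤ 1 := by
            rw [← sq_abs]; exact pow_le_one₀ (abs_nonneg _) (ha t y)
          rw [mul_pow]
          nlinarith [sq_nonneg l]
        have h3 := Real.cosh_pos (l * A)
        nlinarith
      refine (Finset.sum_le_sum h1).trans ?_
      rw [← Finset.mul_sum, Finset.card_insert_of_notMem hy]
      push_cast
      rw [mul_add, Real.exp_add, mul_one]
      have := Real.exp_pos (l ^ 2 / 2)
      nlinarith
    by_cases h : ∑ t ∈ T, Real.cosh (l * ∑ x ∈ insert y S, sg (Function.update g y true x) * a t x)
        ≤ T.card * Real.exp (l ^ 2 / 2 * (insert y S).card)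
    · exact ⟨_, h⟩
    · exact ⟨_, by linarith⟩

lemma signs {ι : Type*} (T : Finset ι) (a : ι → ℕ → ℝ) (ha : ∀ t x, |a t x| ≤ 1) (L : ℝ)
    (hL : 0 < L) (hT : 2 * (T.card : ℝ) ≤ Real.exp L) (S : Finset ℕ) : ∃ g : ℕ → Bool,
      ∀ t ∈ T, |∑ x ∈ S, sg (g x) * a t x| ≤ 3 / 2 * Real.sqrt (L * S.card) := by
  rcases S.eq_empty_or_nonempty with rfl | hS
  · exact ⟨fun _ => true, by simp⟩
  have hn : (0 : ℝ) < S.card := by exact_mod_cast hS.card_pos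
  set n : ℝ := (S.card : ℝ)
  set l := Real.sqrt (L / n) with hl
  have hlp : 0 < l := Real.sqrt_pos.2 (by positivity)
  obtain ⟨g, hg⟩ := potential T a ha l S
  refine ⟨g, fun t ht => ?_⟩
  set A := ∑ x ∈ S, sg (g x) * a t x
  have h1 : Real.cosh (l * A) ≤ T.card * Real.exp (l ^ 2 / 2 * n) :=
    (Finset.single_le_sum (f := fun t => Real.cosh (l * ∑ x ∈ S, sg (g x) * a t x))
      (fun i _ => (Real.cosh_pos _).le) ht).trans hg
  have h2 : Real.exp (l * |A|) ≤ 2 * Real.cosh (l * A) := by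
    rw [← Real.cosh_abs, abs_mul, abs_of_pos hlp, Real.cosh_eq]
    have := Real.exp_pos (-(l * |A|))
    linarith
  have h3 : Real.exp (l * |A|) ≤ Real.exp (L + l ^ 2 / 2 * n) := by
    rw [Real.exp_add]
    have := Real.exp_pos (l ^ 2 / 2 * n)
    nlinarith
  have h4 := Real.exp_le_exp.1 h3
  have h5 : l ^ 2 * n = L := by
    rw [hl, Real.sq_sqrt (by positivity)]; field_simp
  have h6 : Real.sqrt (L * n) = l * n := by
    rw [Real.sqrt_eq_iff_mul_self_eq (by positivity) (by positivity)]
    rw [← h5]; ring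
  rw [h6]
  have h7 : l * |A| ≤ l * (3 / 2 * (l * n)) := by nlinarith
  exact le_of_mul_le_mul_left h7 hlp

lemma expsum (k : ℕ) (S : Finset ℕ) (hS : S ⊆ Finset.range (2 ^ k)) : ∃ g : ℕ → Bool, ∀ ξ : ℝ,
    ‖∑ x ∈ S, (sg (g x) : ℂ) * e (ξ * (x / 2 ^ k))‖ ≤
      12 * (Real.sqrt S.card * Real.sqrt (k + 1)) := by
  classical
  let T : Finset (ℕ × Bool) := Finset.range (4 ^ k) ×ˢ Finset.univ
  let a : ℕ × Bool → ℕ → ℝ := fun t x =>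
    if t.2 then (e ((t.1 / 2 ^ k : ℝ) * (x / 2 ^ k))).re
      else (e ((t.1 / 2 ^ k : ℝ) * (x / 2 ^ k))).im
  have ha : ∀ t x, |a t x| ≤ 1 := by
    intro t x
    simp only [a]
    split_ifs
    · exact (Complex.abs_re_le_norm _).trans (norm_e _).le
    · exact (Complex.abs_im_le_norm _).trans (norm_e _).le
  have hT : 2 * (T.card : ℝ) ≤ Real.exp (2 * (k + 1)) := by
    have h1 : (T.card : ℝ) = 4 ^ k * 2 := by simp [T]
    have h2 : Real.exp (2 * (k + 1)) = (Real.exp 1 ^ 2) ^ (k + 1) := by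
      rw [← pow_mul, ← Real.exp_nat_mul]; push_cast; ring_nf
    rw [h1, h2]
    have h3 : (4 : ℝ) ≤ Real.exp 1 ^ 2 := by
      have := Real.exp_one_gt_d9
      nlinarith
    calc 2 * ((4 : ℝ) ^ k * 2) = 4 ^ (k + 1) := by ring
      _ ≤ _ := pow_le_pow_left₀ (by norm_num) h3 _
  obtain ⟨g, hg⟩ := signs T a ha (2 * (k + 1)) (by positivity) hT S
  refine ⟨g, fun ξ => ?_⟩
  rcases S.eq_empty_or_nonempty with rfl | hne
  · simp
  have hn : (1 : ℝ) ≤ S.card := by exact_mod_cast hne.card_pos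
  have hn2 : (S.card : ℝ) ≤ 2 ^ k := by
    have := Finset.card_le_card hS
    rw [Finset.card_range] at this
    exact_mod_cast this
  have h2k : (0 : ℝ) < 2 ^ k := by positivity
  -- the grid bound
  have hgrid : ∀ j : ℕ, j < 4 ^ k → ‖∑ x ∈ S, (sg (g x) : ℂ) * e ((j / 2 ^ k : ℝ) * (x / 2 ^ k))‖ ≤
      3 * Real.sqrt (2 * (k + 1) * S.card) := by
    intro j hj
    refine (Complex.norm_le_abs_re_add_abs_im _).trans ?_
    have h1 := hg (j, true) (by simp [T, hj])
    have h2 := hg (j, false) (by simp [T, hj])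
    simp only [a, if_true] at h1 h2
    rw [Complex.re_sum, Complex.im_sum]
    simp only [Complex.re_ofReal_mul, Complex.im_ofReal_mul]
    simp only [Bool.false_eq_true, if_false] at h2
    linarith
  -- reduction mod 2^k
  set q : ℤ := ⌊ξ / 2 ^ k⌋
  set η : ℝ := ξ - 2 ^ k * q with hη
  have hη0 : 0 ≤ η := by
    have := Int.floor_le (ξ / 2 ^ k)
    rw [le_div_iff₀ h2k] at this
    simp only [hη]; linarith
  have hη1 : η < 2 ^ k := by
    have := Int.lt_floor_add_one (ξ / 2 ^ k)
    rw [div_lt_iff₀ h2k] at this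
    simp only [hη]; linarith
  have hper : ∀ x : ℕ, e (ξ * (x / 2 ^ k)) = e (η * (x / 2 ^ k)) := by
    intro x
    have : ξ * (x / 2 ^ k) = η * (x / 2 ^ k) + ((q * x : ℤ) : ℝ) := by
      simp only [hη]; push_cast; field_simp; ring
    rw [this, e_add, e_int, mul_one]
  simp_rw [hper]
  set j : ℕ := ⌊η * 2 ^ k⌋₊
  have hj : j < 4 ^ k := by
    rw [Nat.floor_lt (by positivity)]
    push_cast
    calc η * 2 ^ k < 2 ^ k * 2 ^ k := by gcongr
      _ = 4 ^ k := by rw [← mul_pow]; norm_num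
  have hj1 : |η - j / 2 ^ k| ≤ 1 / 2 ^ k := by
    have h1 := Nat.floor_le (a := η * 2 ^ k) (by positivity)
    have h2 := Nat.lt_floor_add_one (η * 2 ^ k)
    have h3 : η - j / 2 ^ k = (η * 2 ^ k - j) / 2 ^ k := by field_simp
    rw [h3, abs_div, abs_of_pos h2k]
    gcongr
    rw [abs_le]; constructor <;> linarith
  have hdiff : ‖∑ x ∈ S, (sg (g x) : ℂ) * e (η * (x / 2 ^ k)) -
      ∑ x ∈ S, (sg (g x) : ℂ) * e ((j / 2 ^ k : ℝ) * (x / 2 ^ k))‖ ≤ 2 * Real.pi := by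
    rw [← Finset.sum_sub_distrib]
    have : ∀ x ∈ S, ‖(sg (g x) : ℂ) * e (η * (x / 2 ^ k)) -
        (sg (g x) : ℂ) * e ((j / 2 ^ k : ℝ) * (x / 2 ^ k))‖ ≤ 2 * Real.pi * (1 / 2 ^ k) := by
      intro x hx
      rw [← mul_sub, norm_mul, Complex.norm_real, Real.norm_eq_abs, sg_abs, one_mul]
      refine (e_sub _ _).trans ?_
      gcongr
      rw [← sub_mul, abs_mul]
      have hx1 : |(x / 2 ^ k : ℝ)| ≤ 1 := by
        rw [abs_of_nonneg (by positivity), div_le_one h2k]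
        exact_mod_cast (Finset.mem_range.1 (hS hx)).le
      calc _ ≤ (1 / 2 ^ k : ℝ) * 1 := mul_le_mul hj1 hx1 (abs_nonneg _) (by positivity)
        _ = _ := mul_one _
    refine (norm_sum_le_of_le _ this).trans ?_
    rw [Finset.sum_const, nsmul_eq_mul]
    have : (S.card : ℝ) * (1 / 2 ^ k) ≤ 1 := by
      rw [mul_one_div, div_le_one h2k]; exact hn2
    have := Real.pi_pos
    nlinarith
  have hfin := norm_le_norm_add_norm_sub' (∑ x ∈ S, (sg (g x) : ℂ) * e (η * (x / 2 ^ k)))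
    (∑ x ∈ S, (sg (g x) : ℂ) * e ((j / 2 ^ k : ℝ) * (x / 2 ^ k)))
  have hs : Real.sqrt (2 * (k + 1) * S.card) =
      Real.sqrt 2 * (Real.sqrt S.card * Real.sqrt (k + 1)) := by
    rw [Real.sqrt_mul (by positivity), Real.sqrt_mul (by positivity)]; ring
  have h1 := hgrid j hj
  rw [hs] at h1
  have hW : 1 ≤ Real.sqrt S.card * Real.sqrt (k + 1) := by
    have h1 : 1 ≤ Real.sqrt S.card := Real.one_le_sqrt.2 hn
    have h2 : 1 ≤ Real.sqrt (k + 1 : ℝ) := Real.one_le_sqrt.2 (by linarith [Nat.cast_nonneg (α := ℝ) k])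
    nlinarith
  have h2 : Real.sqrt 2 ≤ 3 / 2 := by rw [Real.sqrt_le_left (by norm_num)]; norm_num
  have h3 := Real.pi_lt_d2
  nlinarith


lemma sum_bound (β : ℝ) (h0 : 0 < β) (h1 : β < 1) : ∃ C : ℝ, 0 < C ∧ ∀ t : ℝ, 2 ≤ t → ∀ K : ℕ,
    ∑ k ∈ Finset.range K, ((2 : ℝ) ^ (-β)) ^ k * Real.sqrt (k + 1) * min 1 (2 ^ k / t) ≤
      C * (t ^ (-β) * Real.sqrt (Real.log t)) := by
  set q : ℝ := (2 : ℝ) ^ (-β) with hq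
  set p : ℝ := (2 : ℝ) ^ (-(1 - β)) with hp
  have hq0 : 0 < q := by positivity
  have hp0 : 0 < p := by positivity
  have hq1 : q < 1 := Real.rpow_lt_one_of_one_lt_of_neg (by norm_num) (by linarith)
  have hp1 : p < 1 := Real.rpow_lt_one_of_one_lt_of_neg (by norm_num) (by linarith)
  have hpq : q * p = 1 / 2 := by
    rw [hq, hp, ← Real.rpow_add (by norm_num)]
    have : -β + -(1 - β) = -1 := by ring
    rw [this, Real.rpow_neg_one]; norm_num
  have s1 : Summable (fun i : ℕ => p ^ i) := summable_geometric_of_lt_one hp0.le hp1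
  have s2 : Summable (fun i : ℕ => ((i : ℝ) + 2) * q ^ i) := by
    have a1 : Summable (fun i : ℕ => (i : ℝ) ^ 1 * q ^ i) :=
      summable_pow_mul_geometric_of_norm_lt_one 1 (by rwa [Real.norm_of_nonneg hq0.le])
    have a2 : Summable (fun i : ℕ => 2 * q ^ i) :=
      (summable_geometric_of_lt_one hq0.le hq1).mul_left 2
    refine (a1.add a2).congr fun i => ?_
    ring
  set M := (∑' i : ℕ, p ^ i) + ∑' i : ℕ, ((i : ℝ) + 2) * q ^ i with hM
  have hM1 : 0 < ∑' i : ℕ, p ^ i := s1.tsum_pos (fun i => by positivity) 0 (by simp)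
  have hM2 : 0 ≤ ∑' i : ℕ, ((i : ℝ) + 2) * q ^ i := tsum_nonneg fun i => by positivity
  have hM0 : 0 < M := by positivity
  refine ⟨2 * M / q, by positivity, fun t ht K => ?_⟩
  have ht0 : 0 < t := by linarith
  obtain ⟨j, hj1, hj2⟩ := exists_nat_pow_near (x := t) (y := 2) (by linarith) (by norm_num)
  have hjpos : 1 ≤ j := by
    by_contra h
    have : j = 0 := by omega
    subst this
    norm_num at hj2; linarith
  set f : ℕ → ℝ := fun k => q ^ k * Real.sqrt (k + 1) * min 1 (2 ^ k / t) with hf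
  have hf0 : ∀ k, 0 ≤ f k := fun k => by positivity
  set W := Real.sqrt (j + 1) * q ^ j with hW
  have hW0 : 0 ≤ W := by positivity
  have A1 : ∑ k ∈ Finset.range (j + 1), f k ≤ W * ∑' i : ℕ, p ^ i := by
    rw [← Finset.sum_range_reflect]
    refine (Finset.sum_le_sum (g := fun i => W * p ^ i) fun i hi => ?_).trans ?_
    · have hi' : i ≤ j := by simpa [Nat.lt_succ_iff] using hi
      have : j + 1 - 1 - i = j - i := by omega
      rw [this]
      obtain ⟨k, rfl⟩ := Nat.exists_eq_add_of_le hi'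
      have : i + k - i = k := by omega
      rw [this]
      simp only [hf, hW]
      have b1 : Real.sqrt ((k : ℝ) + 1) ≤ Real.sqrt (((i + k : ℕ) : ℝ) + 1) := by
        apply Real.sqrt_le_sqrt; push_cast; linarith [Nat.cast_nonneg (α := ℝ) i]
      have b2 : min 1 (2 ^ k / t) ≤ (1 / 2 : ℝ) ^ i := by
        refine (min_le_right _ _).trans ?_
        rw [div_le_iff₀ ht0]
        calc (2 : ℝ) ^ k = (1 / 2) ^ i * 2 ^ (i + k) := by
              rw [pow_add, ← mul_assoc, ← mul_pow]; norm_num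
          _ ≤ _ := by gcongr
      calc q ^ k * Real.sqrt (k + 1) * min 1 (2 ^ k / t)
          ≤ q ^ k * Real.sqrt (((i + k : ℕ) : ℝ) + 1) * (1 / 2 : ℝ) ^ i := by gcongr
        _ = _ := by rw [← hpq, mul_pow, pow_add]; ring
    · rw [← Finset.mul_sum]
      gcongr
      exact s1.sum_le_tsum _ fun i _ => by positivity
  have A2 : ∑ i ∈ Finset.range K, f (j + 1 + i) ≤ W * ∑' i : ℕ, ((i : ℝ) + 2) * q ^ i := by
    refine (Finset.sum_le_sum (g := fun i : ℕ => W * (((i : ℝ) + 2) * q ^ i)) fun i _ => ?_).trans ?_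
    · simp only [hf, hW]
      have b1 : Real.sqrt (((j + 1 + i : ℕ) : ℝ) + 1) ≤ Real.sqrt (j + 1) * (i + 2) := by
        rw [Real.sqrt_le_left (by positivity), mul_pow, Real.sq_sqrt (by positivity)]
        push_cast
        have := Nat.cast_nonneg (α := ℝ) i
        have := Nat.cast_nonneg (α := ℝ) j
        nlinarith [mul_nonneg (Nat.cast_nonneg (α := ℝ) i) (Nat.cast_nonneg (α := ℝ) j),
          mul_nonneg (mul_nonneg (Nat.cast_nonneg (α := ℝ) i) (Nat.cast_nonneg (α := ℝ) i)) (Nat.cast_nonneg (α := ℝ) j)]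
      have b3 : q ^ (j + 1 + i) ≤ q ^ j * q ^ i := by
        rw [← pow_add]
        exact pow_le_pow_of_le_one hq0.le hq1.le (by omega)
      calc q ^ (j + 1 + i) * Real.sqrt (((j + 1 + i : ℕ) : ℝ) + 1) * min 1 (2 ^ (j + 1 + i) / t)
          ≤ (q ^ j * q ^ i) * (Real.sqrt (j + 1) * (i + 2)) * 1 := by
            gcongr
            exact min_le_left _ _
        _ = _ := by ring
    · rw [← Finset.mul_sum]
      gcongr
      exact s2.sum_le_tsum _ fun i _ => by positivity
  have A3 : ∑ k ∈ Finset.range K, f k ≤ W * M := by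
    calc _ ≤ ∑ k ∈ Finset.range (j + 1 + K), f k :=
          Finset.sum_le_sum_of_subset_of_nonneg (Finset.range_mono (by omega)) fun i _ _ => hf0 i
      _ = _ := Finset.sum_range_add f (j + 1) K
      _ ≤ _ := by rw [hM, mul_add]; exact add_le_add A1 A2
  refine A3.trans ?_
  have B1 : q ^ j ≤ t ^ (-β) / q := by
    rw [le_div_iff₀ hq0, ← pow_succ, hq, ← Real.rpow_natCast, ← Real.rpow_mul (by norm_num),
      mul_comm, Real.rpow_mul (by norm_num), Real.rpow_natCast]
    exact Real.rpow_le_rpow_of_nonpos ht0 hj2.le (by linarith)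
  have B2 : Real.sqrt (j + 1) ≤ 2 * Real.sqrt (Real.log t) := by
    have l1 : j * Real.log 2 ≤ Real.log t := by
      rw [← Real.log_pow]; exact Real.log_le_log (by positivity) hj1
    have l2 := Real.log_two_gt_d9
    have l3 : (1 : ℝ) ≤ j := by exact_mod_cast hjpos
    have : (2 : ℝ) * Real.sqrt (Real.log t) = Real.sqrt (4 * Real.log t) := by
      rw [Real.sqrt_mul (by norm_num)]; congr 1
      rw [show (4 : ℝ) = 2 ^ 2 by norm_num, Real.sqrt_sq (by norm_num)]
    rw [this]
    apply Real.sqrt_le_sqrt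
    nlinarith
  calc W * M ≤ (2 * Real.sqrt (Real.log t)) * (t ^ (-β) / q) * M := by
        rw [hW]; gcongr
    _ = _ := by ring
/-- normalized Fourier transform of the unit interval -/
def sc (η : ℝ) : ℂ := (1 - e η) / (2 * Real.pi * Complex.I * η)

lemma sc_den (η : ℝ) : ‖(2 * Real.pi * Complex.I * η : ℂ)‖ = 2 * Real.pi * |η| := by
  simp [abs_of_pos Real.pi_pos]

lemma sc_le_one (η : ℝ) : ‖sc η‖ ≤ 1 := by
  unfold sc
  rw [norm_div, sc_den, norm_sub_rev]
  exact div_le_one_of_le₀ (e_sub_one η) (by positivity)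

lemma sc_le_inv (η : ℝ) (h : η ≠ 0) : ‖sc η‖ ≤ 1 / |η| := by
  unfold sc
  rw [norm_div, sc_den]
  have h0 : 0 < |η| := abs_pos.2 h
  have h1 : ‖1 - e η‖ ≤ 2 := by
    refine (norm_sub_le _ _).trans ?_
    rw [norm_e]; norm_num
  have := Real.pi_gt_three
  rw [div_le_div_iff₀ (by positivity) h0]
  nlinarith

lemma sc_double (η : ℝ) (h : η ≠ 0) : sc (2 * η) = sc η * ((1 + e η) / 2) := by
  unfold sc
  rw [two_mul, e_add]
  have h1 : (η : ℂ) ≠ 0 := by exact_mod_cast h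
  have h2 : (Real.pi : ℂ) ≠ 0 := by exact_mod_cast Real.pi_ne_zero
  have h3 := Complex.I_ne_zero
  push_cast
  rw [← two_mul]
  field_simp
  ring

lemma sc_tendsto (ξ : ℝ) (h : ξ ≠ 0) :
    Filter.Tendsto (fun k : ℕ => sc (ξ / 2 ^ k)) Filter.atTop (nhds 1) := by
  have hd : HasDerivAt e (-(2 * Real.pi * Complex.I)) 0 := by
    have h1 : HasDerivAt (fun t : ℝ => Complex.I * ((-(2 * Real.pi * t) : ℝ) : ℂ))
        (Complex.I * ((-(2 * Real.pi * 1) : ℝ) : ℂ)) 0 :=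
      (((hasDerivAt_id (0 : ℝ)).const_mul (2 * Real.pi)).neg.ofReal_comp).const_mul Complex.I
    have h2 := h1.cexp
    have h3 : Complex.exp (Complex.I * ((-(2 * Real.pi * 0) : ℝ) : ℂ)) *
        (Complex.I * ((-(2 * Real.pi * 1) : ℝ) : ℂ)) = -(2 * Real.pi * Complex.I) := by
      simp; ring
    rw [h3] at h2
    exact h2
  have h3 := hd.tendsto_slope_zero
  have h4 : Filter.Tendsto (fun k : ℕ => ξ / 2 ^ k) Filter.atTop (nhdsWithin 0 {0}ᶜ) := by
    rw [tendsto_nhdsWithin_iff]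
    constructor
    · have := (tendsto_pow_atTop_nhds_zero_of_lt_one (r := (1 / 2 : ℝ)) (by norm_num)
        (by norm_num)).const_mul ξ
      simp only [mul_zero] at this
      refine this.congr fun k => ?_
      rw [one_div, inv_pow]; rfl
    · filter_upwards with k
      simp [h]
  have h5 := ((h3.comp h4).mul_const (-(1 / (2 * Real.pi * Complex.I)) : ℂ))
  have h2 : (Real.pi : ℂ) ≠ 0 := by exact_mod_cast Real.pi_ne_zero
  have hI := Complex.I_ne_zero
  have h6 : -(2 * Real.pi * Complex.I) * (-(1 / (2 * Real.pi * Complex.I)) : ℂ) = 1 := by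
    field_simp
  rw [h6] at h5
  refine h5.congr fun k => ?_
  have h7 : (ξ : ℂ) ≠ 0 := by exact_mod_cast h
  simp only [Function.comp, sc, zero_add, e_zero, Complex.real_smul]
  push_cast
  field_simp
  ring

variable (G : ℕ → Finset ℕ → ℕ → Bool) (fr : ℕ → Bool)

/-- level sets -/
def St : ℕ → Finset ℕ
  | 0 => {0}
  | k + 1 => if fr k then (St k).image (fun x => 2 * x) ∪ (St k).image (fun x => 2 * x + 1)
      else (St k).image (fun x => 2 * x + (G k (St k) x).toNat)

/-- level-k numerator -/
def X (ω : ℕ → Bool) : ℕ → ℕ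
  | 0 => 0
  | k + 1 => 2 * X ω k + (if fr k then ω k else G k (St G fr k) (X ω k)).toNat

/-- number of free digits -/
def cnt (k : ℕ) : ℕ := ((Finset.range k).filter (fun i => fr i)).card

lemma cnt_succ (k : ℕ) : cnt fr (k + 1) = cnt fr k + (fr k).toNat := by
  unfold cnt
  rw [Finset.range_add_one, Finset.filter_insert]
  split_ifs with h
  · rw [Finset.card_insert_of_notMem (by simp)]; simp [h]
  · simp [h]

lemma St_sum {M : Type*} [AddCommMonoid M] (f : ℕ → M) (k : ℕ) :
    ∑ a ∈ St G fr (k + 1), f a = if fr k then ∑ a ∈ St G fr k, (f (2 * a) + f (2 * a + 1))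
      else ∑ a ∈ St G fr k, f (2 * a + (G k (St G fr k) a).toNat) := by
  rw [St]
  split_ifs with h
  · rw [Finset.sum_union, Finset.sum_image, Finset.sum_image, Finset.sum_add_distrib]
    · intro x _ y _ h; simpa using h
    · intro x _ y _ h; simpa using h
    · rw [Finset.disjoint_left]
      intro z hz hz'
      simp only [Finset.mem_image] at hz hz'
      obtain ⟨x, _, rfl⟩ := hz
      obtain ⟨y, _, hy⟩ := hz'
      omega
  · rw [Finset.sum_image]
    intro x _ y _ h
    have h1 := Bool.toNat_le (G k (St G fr k) x)
    have h2 := Bool.toNat_le (G k (St G fr k) y)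
    simp only at h
    omega

lemma St_card (k : ℕ) : (St G fr k).card = 2 ^ cnt fr k := by
  induction k with
  | zero => simp [St, cnt]
  | succ k ih =>
    rw [Finset.card_eq_sum_ones, St_sum, cnt_succ]
    cases fr k
    · simp [ih]
    · simp [ih, pow_succ]

lemma St_subset (k : ℕ) : St G fr k ⊆ Finset.range (2 ^ k) := by
  induction k with
  | zero => simp [St]
  | succ k ih =>
    intro z hz
    have key : ∀ x ∈ St G fr k, x < 2 ^ k := fun x hx => Finset.mem_range.1 (ih hx)
    rw [St] at hz
    rw [Finset.mem_range, pow_succ]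
    split_ifs at hz with h
    · simp only [Finset.mem_union, Finset.mem_image] at hz
      rcases hz with ⟨x, hx, rfl⟩ | ⟨x, hx, rfl⟩ <;> have := key x hx <;> omega
    · simp only [Finset.mem_image] at hz
      obtain ⟨x, hx, rfl⟩ := hz
      have := key x hx
      have := Bool.toNat_le (G k (St G fr k) x)
      omega

lemma X_mem (ω : ℕ → Bool) (k : ℕ) : X G fr ω k ∈ St G fr k := by
  induction k with
  | zero => simp [St, X]
  | succ k ih =>
    rw [St, X]
    split_ifs with h
    · simp only [Finset.mem_union, Finset.mem_image]
      cases ω k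
      · exact Or.inl ⟨_, ih, by simp⟩
      · exact Or.inr ⟨_, ih, by simp⟩
    · exact Finset.mem_image.2 ⟨_, ih, rfl⟩

lemma X_fiber (k : ℕ) : ∀ a ∈ St G fr k, ∃ v : ℕ → Bool, {ω | X G fr ω k = a} =
    Set.pi ((Finset.range k).filter (fun i => fr i) : Finset ℕ) (fun i => {v i}) := by
  induction k with
  | zero => intro a ha; simp [St] at ha; subst ha; exact ⟨fun _ => true, by simp [X]⟩
  | succ k ih =>
    intro a ha
    rw [St] at ha
    split_ifs at ha with h
    · have : ∃ x ∈ St G fr k, ∃ b : Bool, a = 2 * x + b.toNat := by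
        simp only [Finset.mem_union, Finset.mem_image] at ha
        rcases ha with ⟨x, hx, rfl⟩ | ⟨x, hx, rfl⟩
        · exact ⟨x, hx, false, by simp⟩
        · exact ⟨x, hx, true, by simp⟩
      obtain ⟨x, hx, b, rfl⟩ := this
      obtain ⟨v, hv⟩ := ih x hx
      refine ⟨Function.update v k b, ?_⟩
      ext ω
      have hv' : X G fr ω k = x ↔ ∀ i < k, fr i = true → ω i = v i := by
        have := Set.ext_iff.1 hv ω
        simpa [Set.mem_pi] using this
      have e1 : X G fr ω (k + 1) = 2 * x + b.toNat ↔ X G fr ω k = x ∧ ω k = b := by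
        rw [X, if_pos h]
        cases ω k <;> cases b <;> simp <;> omega
      simp only [Set.mem_ofPred_eq, e1, hv', Set.mem_pi, Finset.coe_filter, Finset.mem_range,
        Set.mem_singleton_iff]
      constructor
      · rintro ⟨h1, h2⟩ i ⟨hi, hfi⟩
        rcases Nat.lt_succ_iff_lt_or_eq.1 hi with h3 | rfl
        · rw [Function.update_of_ne h3.ne]; exact h1 i h3 hfi
        · simpa using h2
      · intro h1
        refine ⟨fun i hi hfi => ?_, ?_⟩
        · have := h1 i ⟨by omega, hfi⟩
          rwa [Function.update_of_ne hi.ne] at this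
        · simpa using h1 k ⟨by omega, h⟩
    · obtain ⟨x, hx, rfl⟩ := Finset.mem_image.1 ha
      obtain ⟨v, hv⟩ := ih x hx
      refine ⟨v, ?_⟩
      have e0 : (Finset.range (k + 1)).filter (fun i => fr i) =
          (Finset.range k).filter (fun i => fr i) := by
        rw [Finset.range_add_one, Finset.filter_insert, if_neg h]
      rw [e0, ← hv]
      ext ω
      simp only [Set.mem_ofPred_eq]
      rw [X, if_neg h]
      constructor
      · intro h1
        have := Bool.toNat_le (G k (St G fr k) x)
        have := Bool.toNat_le (G k (St G fr k) (X G fr ω k))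
        omega
      · intro h1; rw [h1]

/-- fair coin -/
def coin : Measure Bool := (PMF.uniformOfFintype Bool).toMeasure

instance : IsProbabilityMeasure coin := by unfold coin; infer_instance

lemma coin_singleton (b : Bool) : coin {b} = 1 / 2 := by
  unfold coin
  rw [PMF.toMeasure_apply_singleton _ _ (measurableSet_singleton b)]
  simp

/-- coin tossing -/
def P : Measure (ℕ → Bool) := Measure.infinitePi (fun _ => coin)

instance : IsProbabilityMeasure P := by unfold P; infer_instance

lemma P_fiber (k : ℕ) (a : ℕ) (ha : a ∈ St G fr k) :
    P.real {ω | X G fr ω k = a} = 1 / 2 ^ cnt fr k := by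
  obtain ⟨v, hv⟩ := X_fiber G fr k a ha
  rw [hv, measureReal_def, P, Measure.infinitePi_pi _ (fun i _ => measurableSet_singleton _)]
  simp_rw [coin_singleton]
  rw [Finset.prod_const]
  simp [cnt]

lemma X_cont (k : ℕ) : Continuous (fun ω => X G fr ω k) := by
  induction k with
  | zero => simp only [X]; exact continuous_const
  | succ k ih =>
    have h1 : Continuous (fun ω : ℕ → Bool => (X G fr ω k, ω k)) :=
      ih.prodMk (continuous_apply k)
    have h2 : Continuous (fun z : ℕ × Bool =>
      2 * z.1 + (if fr k then z.2 else G k (St G fr k) z.1).toNat) := continuous_of_discreteTopology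
    exact h2.comp h1

/-- the coding map -/
def Phi (ω : ℕ → Bool) : ℝ := ⨆ k : ℕ, (X G fr ω k : ℝ) / 2 ^ k

lemma Phi_mem (ω : ℕ → Bool) (k : ℕ) :
    Phi G fr ω ∈ Set.Icc ((X G fr ω k : ℝ) / 2 ^ k) (((X G fr ω k : ℝ) + 1) / 2 ^ k) := by
  have hX : ∀ k, ∃ d : ℝ, 0 ≤ d ∧ d ≤ 1 ∧ (X G fr ω (k + 1) : ℝ) = 2 * X G fr ω k + d := by
    intro k
    refine ⟨((if fr k then ω k else G k (St G fr k) (X G fr ω k)).toNat : ℝ), by positivity, ?_, ?_⟩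
    · exact_mod_cast Bool.toNat_le _
    · rw [X]; push_cast; ring
  have := Monotone.ciSup_mem_iInter_Icc_of_antitone (f := fun k : ℕ => (X G fr ω k : ℝ) / 2 ^ k)
    (g := fun k : ℕ => ((X G fr ω k : ℝ) + 1) / 2 ^ k) ?_ ?_ ?_
  · exact Set.mem_iInter.1 this k
  · refine monotone_nat_of_le_succ fun k => ?_
    obtain ⟨d, h0, h1, h2⟩ := hX k
    rw [h2, pow_succ, div_le_div_iff₀ (by positivity) (by positivity)]
    have : (0 : ℝ) < 2 ^ k := by positivity
    nlinarith
  · refine antitone_nat_of_succ_le fun k => ?_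
    obtain ⟨d, h0, h1, h2⟩ := hX k
    rw [h2, pow_succ, div_le_div_iff₀ (by positivity) (by positivity)]
    have : (0 : ℝ) < 2 ^ k := by positivity
    nlinarith
  · intro k
    have : (0 : ℝ) < 2 ^ k := by positivity
    exact div_le_div_of_nonneg_right (by linarith) this.le

lemma Phi_cont : Continuous (Phi G fr) := by
  have hu : TendstoUniformly (fun (k : ℕ) ω => (X G fr ω k : ℝ) / 2 ^ k) (Phi G fr)
      Filter.atTop := by
    rw [Metric.tendstoUniformly_iff]
    intro ε hε
    obtain ⟨n, hn⟩ := exists_pow_lt_of_lt_one hε (y := (1 / 2 : ℝ)) (by norm_num)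
    filter_upwards [Filter.eventually_ge_atTop n] with k hk ω
    have h1 := Phi_mem G fr ω k
    rw [Real.dist_eq, abs_of_nonneg (by linarith [h1.1])]
    have h2 : ((X G fr ω k : ℝ) + 1) / 2 ^ k = X G fr ω k / 2 ^ k + (1 / 2) ^ k := by
      rw [add_div, one_div_pow]
    have h3 : (1 / 2 : ℝ) ^ k ≤ (1 / 2) ^ n :=
      pow_le_pow_of_le_one (by norm_num) (by norm_num) hk
    linarith [h1.2]
  refine hu.continuous (Filter.Frequently.of_forall fun k => ?_)
  have : Continuous (fun n : ℕ => (n : ℝ) / 2 ^ k) := continuous_of_discreteTopology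
  exact this.comp (X_cont G fr k)

/-- average over level sets -/
def Av (k : ℕ) (ξ : ℝ) : ℂ :=
  (1 / 2 ^ cnt fr k : ℂ) * ∑ a ∈ St G fr k, e (ξ * ((a : ℝ) / 2 ^ k))

lemma e_cont : Continuous e := by unfold e; fun_prop

lemma Av_eq (k : ℕ) (ξ : ℝ) : ∫ ω, e (ξ * ((X G fr ω k : ℝ) / 2 ^ k)) ∂P = Av G fr k ξ := by
  have h1 : ∀ ω, e (ξ * ((X G fr ω k : ℝ) / 2 ^ k)) = ∑ a ∈ St G fr k,
      Set.indicator {ω | X G fr ω k = a} (fun _ => e (ξ * ((a : ℝ) / 2 ^ k))) ω := by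
    intro ω
    rw [Finset.sum_eq_single (X G fr ω k)]
    · simp
    · intro b _ hb
      rw [Set.indicator_of_notMem]
      exact fun h => hb h.symm
    · intro h; exact absurd (X_mem G fr ω k) h
  have hm : ∀ a, MeasurableSet {ω | X G fr ω k = a} := fun a =>
    (X_cont G fr k).measurable (measurableSet_singleton a)
  simp_rw [h1]
  rw [integral_finsetSum, Av, Finset.mul_sum]
  · refine Finset.sum_congr rfl fun a ha => ?_
    rw [integral_indicator_const _ (hm a), P_fiber G fr k a ha, Complex.real_smul]
    push_cast; rfl
  · intro a _
    exact (integrable_const _).indicator (hm a)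

lemma integrable_e {f : (ℕ → Bool) → ℝ} (hf : Continuous f) : Integrable (fun ω => e (f ω)) P :=
  Integrable.of_bound (e_cont.comp hf).aestronglyMeasurable 1
    (Filter.Eventually.of_forall fun _ => (norm_e _).le)

lemma Av_tendsto (ξ : ℝ) :
    Filter.Tendsto (fun k => Av G fr k ξ) Filter.atTop (nhds (∫ ω, e (ξ * Phi G fr ω) ∂P)) := by
  rw [tendsto_iff_norm_sub_tendsto_zero]
  have hlim : Filter.Tendsto (fun k : ℕ => 2 * Real.pi * |ξ| * (1 / 2 : ℝ) ^ k) Filter.atTop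
      (nhds 0) := by
    simpa using (tendsto_pow_atTop_nhds_zero_of_lt_one (r := (1 / 2 : ℝ)) (by norm_num)
        (by norm_num)).const_mul (2 * Real.pi * |ξ|)
  refine squeeze_zero (fun _ => norm_nonneg _) (fun k => ?_) hlim
  have hc : Continuous (fun ω => (X G fr ω k : ℝ) / 2 ^ k) := by
    have : Continuous (fun n : ℕ => (n : ℝ) / 2 ^ k) := continuous_of_discreteTopology
    exact this.comp (X_cont G fr k)
  rw [← Av_eq, ← integral_sub (integrable_e (hc.const_mul ξ))
    (integrable_e ((Phi_cont G fr).const_mul ξ))]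
  refine (norm_integral_le_of_norm_le_const (C := 2 * Real.pi * |ξ| * (1 / 2 : ℝ) ^ k)
    (Filter.Eventually.of_forall fun ω => ?_)).trans ?_
  · refine (e_sub _ _).trans ?_
    rw [← mul_sub, abs_mul, ← mul_assoc]
    gcongr
    have h1 := Phi_mem G fr ω k
    have h2 : ((X G fr ω k : ℝ) + 1) / 2 ^ k = X G fr ω k / 2 ^ k + (1 / 2) ^ k := by
      rw [add_div, one_div_pow]
    rw [abs_le]; constructor <;> linarith [h1.1, h1.2]
  · simp

lemma step (hG : ∀ k S, S ⊆ Finset.range (2 ^ k) → ∀ ξ : ℝ,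
      ‖∑ x ∈ S, (sg (G k S x) : ℂ) * e (ξ * (x / 2 ^ k))‖ ≤
      12 * (Real.sqrt S.card * Real.sqrt (k + 1))) (k : ℕ) (ξ : ℝ) (hξ : ξ ≠ 0) :
    ‖Av G fr (k + 1) ξ * sc (ξ / 2 ^ (k + 1)) - Av G fr k ξ * sc (ξ / 2 ^ k)‖ ≤
      12 * (Real.sqrt (k + 1) / Real.sqrt (2 ^ cnt fr k)) * ‖sc (ξ / 2 ^ (k + 1))‖ := by
  set η := ξ / 2 ^ (k + 1) with hη
  have hη0 : η ≠ 0 := by positivity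
  have h2 : ξ / 2 ^ k = 2 * η := by rw [hη, pow_succ]; field_simp
  rw [h2, sc_double η hη0]
  have key0 : ∀ a : ℕ, e (ξ * (((2 * a : ℕ) : ℝ) / 2 ^ (k + 1))) = e (ξ * ((a : ℝ) / 2 ^ k)) := by
    intro a; congr 1; push_cast; rw [pow_succ]; field_simp
  have key1 : ∀ a : ℕ, e (ξ * (((2 * a + 1 : ℕ) : ℝ) / 2 ^ (k + 1))) =
      e (ξ * ((a : ℝ) / 2 ^ k)) * e η := by
    intro a; rw [← e_add]; congr 1; rw [hη]; push_cast; rw [pow_succ]; field_simp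
  unfold Av
  rw [St_sum, cnt_succ]
  cases hfr : fr k
  · simp only [Bool.false_eq_true, if_false, Bool.toNat_false, add_zero]
    have key : ∀ a : ℕ, e (ξ * (((2 * a + (G k (St G fr k) a).toNat : ℕ) : ℝ) / 2 ^ (k + 1))) =
        e (ξ * ((a : ℝ) / 2 ^ k)) * ((1 + e η) / 2) +
        ((sg (G k (St G fr k) a) : ℂ) * e (ξ * ((a : ℝ) / 2 ^ k))) * ((1 - e η) / 2) := by
      intro a
      cases G k (St G fr k) a
      · simp only [Bool.toNat_false, add_zero, key0, sg]; simp; ring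
      · simp only [Bool.toNat_true, key1, sg]; simp; ring
    simp_rw [key]
    rw [Finset.sum_add_distrib, ← Finset.sum_mul, ← Finset.sum_mul]
    set A := ∑ a ∈ St G fr k, e (ξ * ((a : ℝ) / 2 ^ k))
    set D := ∑ a ∈ St G fr k, (sg (G k (St G fr k) a) : ℂ) * e (ξ * ((a : ℝ) / 2 ^ k)) with hD
    have hDb := hG k (St G fr k) (St_subset G fr k) ξ
    rw [← hD, St_card] at hDb
    have : (1 / 2 ^ cnt fr k : ℂ) * (A * ((1 + e η) / 2) + D * ((1 - e η) / 2)) * sc η -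
        (1 / 2 ^ cnt fr k : ℂ) * A * (sc η * ((1 + e η) / 2)) =
        (1 / 2 ^ cnt fr k : ℂ) * D * ((1 - e η) / 2) * sc η := by ring
    rw [this, norm_mul, norm_mul, norm_mul]
    refine mul_le_mul_of_nonneg_right ?_ (norm_nonneg _)
    have h5 : ‖(1 - e η) / 2‖ ≤ 1 := by
      rw [norm_div]
      have h1 : ‖1 - e η‖ ≤ 2 := by
        refine (norm_sub_le _ _).trans ?_
        rw [norm_e]; norm_num
      simp only [Complex.norm_ofNat]
      linarith
    have h6 : ‖(1 / 2 ^ cnt fr k : ℂ)‖ = 1 / 2 ^ cnt fr k := by simp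
    rw [h6]
    push_cast at hDb
    set N : ℝ := 2 ^ cnt fr k with hN
    have hNp : 0 < N := by positivity
    have hs : Real.sqrt N / N = 1 / Real.sqrt N := Real.sqrt_div_self'
    calc 1 / N * ‖D‖ * ‖(1 - e η) / 2‖ ≤
        1 / N * (12 * (Real.sqrt N * Real.sqrt (k + 1))) * 1 := by gcongr
      _ = 12 * Real.sqrt (k + 1) * (Real.sqrt N / N) := by ring
      _ = _ := by rw [hs]; ring
  · simp only [if_true, Bool.toNat_true]
    simp_rw [key0, key1]
    have h7 : ∀ a : ℕ, e (ξ * ((a : ℝ) / 2 ^ k)) + e (ξ * ((a : ℝ) / 2 ^ k)) * e η =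
      e (ξ * ((a : ℝ) / 2 ^ k)) * (1 + e η) := fun a => by ring
    simp_rw [h7]
    rw [← Finset.sum_mul]
    have : ∀ A : ℂ, (1 / 2 ^ (cnt fr k + 1) : ℂ) * (A * (1 + e η)) * sc η -
        (1 / 2 ^ cnt fr k : ℂ) * A * (sc η * ((1 + e η) / 2)) = 0 := by
      intro A; rw [pow_succ]; field_simp; ring
    rw [this, norm_zero]
    positivity

/-- the free levels -/
def frα (α : ℝ) (k : ℕ) : Bool := decide (⌊(k : ℝ) * α⌋₊ < ⌊((k + 1 : ℕ) : ℝ) * α⌋₊)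

lemma cnt_eq (α : ℝ) (h0 : 0 < α) (h1 : α < 1) (k : ℕ) : cnt (frα α) k = ⌊(k : ℝ) * α⌋₊ := by
  induction k with
  | zero => simp [cnt]
  | succ k ih =>
    rw [cnt_succ, ih]
    have a1 : ⌊(k : ℝ) * α⌋₊ ≤ ⌊((k + 1 : ℕ) : ℝ) * α⌋₊ := by
      apply Nat.floor_le_floor; push_cast; nlinarith
    have a2 : ⌊((k + 1 : ℕ) : ℝ) * α⌋₊ ≤ ⌊(k : ℝ) * α⌋₊ + 1 := by
      rw [← Nat.floor_add_one (by positivity)]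
      apply Nat.floor_le_floor; push_cast; nlinarith
    unfold frα
    by_cases h : ⌊(k : ℝ) * α⌋₊ < ⌊((k + 1 : ℕ) : ℝ) * α⌋₊
    · rw [decide_eq_true h, Bool.toNat_true]; omega
    · rw [decide_eq_false h, Bool.toNat_false]; omega

lemma cnt_bound (α : ℝ) (h0 : 0 < α) (h1 : α < 1) (k : ℕ) :
    ((1 / 2 : ℝ) ^ k) ^ α ≤ 1 / 2 ^ cnt (frα α) k ∧
      1 / 2 ^ cnt (frα α) k ≤ 2 * ((1 / 2 : ℝ) ^ k) ^ α := by
  have e1 : ((1 / 2 : ℝ) ^ k) ^ α = 1 / (2 : ℝ) ^ ((k : ℝ) * α) := by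
    rw [one_div_pow, Real.div_rpow (by norm_num) (by positivity), Real.one_rpow,
      Real.rpow_mul (by norm_num), Real.rpow_natCast]
  have f1 := Nat.floor_le (a := (k : ℝ) * α) (by positivity)
  have f2 := Nat.lt_floor_add_one ((k : ℝ) * α)
  rw [e1, cnt_eq α h0 h1]
  have g1 : (2 : ℝ) ^ ⌊(k : ℝ) * α⌋₊ ≤ (2 : ℝ) ^ ((k : ℝ) * α) := by
    rw [← Real.rpow_natCast]
    exact Real.rpow_le_rpow_of_exponent_le (by norm_num) f1
  have g2 : (2 : ℝ) ^ ((k : ℝ) * α) ≤ 2 * (2 : ℝ) ^ ⌊(k : ℝ) * α⌋₊ := by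
    rw [← pow_succ', ← Real.rpow_natCast]
    exact Real.rpow_le_rpow_of_exponent_le (by norm_num) (by push_cast; exact f2.le)
  refine ⟨one_div_le_one_div_of_le (by positivity) g1, ?_⟩
  rw [mul_one_div, div_le_div_iff₀ (by positivity) (by positivity)]
  linarith

lemma fourier_bound (hG : ∀ k S, S ⊆ Finset.range (2 ^ k) → ∀ ξ : ℝ,
      ‖∑ x ∈ S, (sg (G k S x) : ℂ) * e (ξ * (x / 2 ^ k))‖ ≤
      12 * (Real.sqrt S.card * Real.sqrt (k + 1)))
    (α : ℝ) (h0 : 0 < α) (h1 : α < 1) : ∃ C : ℝ, 0 < C ∧ ∀ ξ : ℝ, 2 ≤ |ξ| →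
    ‖∫ ω, e (ξ * Phi G (frα α) ω) ∂P‖ ≤ C * (|ξ| ^ (-(α / 2)) * Real.sqrt (Real.log |ξ|)) := by
  obtain ⟨C, hC, hb⟩ := sum_bound (α / 2) (by linarith) (by linarith)
  refine ⟨2 + 48 * C, by positivity, fun ξ hξ => ?_⟩
  have hξp : 0 < |ξ| := by linarith
  have hξ0 : ξ ≠ 0 := abs_pos.1 hξp
  set fr := frα α with hfr
  have hlim := (Av_tendsto G fr ξ).mul (sc_tendsto ξ hξ0)
  rw [mul_one] at hlim
  refine le_of_tendsto hlim.norm (Filter.Eventually.of_forall fun K => ?_)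
  set B : ℕ → ℂ := fun k => Av G fr k ξ * sc (ξ / 2 ^ k) with hB
  have hq : ∀ k : ℕ, Real.sqrt (k + 1) / Real.sqrt (2 ^ cnt fr k) ≤
      2 * (((2 : ℝ) ^ (-(α / 2))) ^ k * Real.sqrt (k + 1)) := by
    intro k
    have b := (cnt_bound α h0 h1 k).2
    have e1 : (((2 : ℝ) ^ (-(α / 2))) ^ k) ^ 2 = ((1 / 2 : ℝ) ^ k) ^ α := by
      rw [← pow_mul, mul_comm, pow_mul, ← Real.rpow_mul_natCast (by norm_num)]
      have : -(α / 2) * ((2 : ℕ) : ℝ) = -α := by push_cast; ring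
      rw [this, ← Real.rpow_natCast, ← Real.rpow_natCast, ← Real.rpow_mul (by norm_num),
        ← Real.rpow_mul (by norm_num), one_div, Real.inv_rpow (by norm_num),
        ← Real.rpow_neg (by norm_num)]
      congr 1; ring
    have e2 : 1 / Real.sqrt (2 ^ cnt fr k) ≤ 2 * ((2 : ℝ) ^ (-(α / 2))) ^ k := by
      refine (sq_le_sq₀ (by positivity) (by positivity)).1 ?_
      rw [div_pow, Real.sq_sqrt (by positivity), mul_pow, e1, one_pow]
      have : 0 ≤ ((1 / 2 : ℝ) ^ k) ^ α := by positivity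
      linarith
    have := mul_le_mul_of_nonneg_right e2 (Real.sqrt_nonneg (k + 1))
    calc _ = 1 / Real.sqrt (2 ^ cnt fr k) * Real.sqrt (k + 1) := by ring
      _ ≤ _ := this
      _ = _ := by ring
  have hs : ∀ k : ℕ, ‖sc (ξ / 2 ^ (k + 1))‖ ≤ 2 * min 1 (2 ^ k / |ξ|) := by
    intro k
    have a1 := sc_le_one (ξ / 2 ^ (k + 1))
    have a2 := sc_le_inv (ξ / 2 ^ (k + 1)) (by positivity)
    rw [abs_div, abs_of_pos (by positivity : (0 : ℝ) < 2 ^ (k + 1)), one_div_div, pow_succ] at a2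
    rw [mul_min_of_nonneg _ _ (by norm_num)]
    refine le_min (by linarith) (a2.trans (le_of_eq (by ring)))
  have hstep : ∀ k, ‖B (k + 1) - B k‖ ≤
      48 * (((2 : ℝ) ^ (-(α / 2))) ^ k * Real.sqrt (k + 1) * min 1 (2 ^ k / |ξ|)) := by
    intro k
    refine (step G fr hG k ξ hξ0).trans ?_
    calc _ ≤ 12 * (2 * (((2 : ℝ) ^ (-(α / 2))) ^ k * Real.sqrt (k + 1))) *
          (2 * min 1 (2 ^ k / |ξ|)) := by
          gcongr
          · exact hq k
          · exact hs k
      _ = _ := by ring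
  have hsum : B K = B 0 + ∑ k ∈ Finset.range K, (B (k + 1) - B k) := by
    rw [Finset.sum_range_sub]; ring
  have hB0 : ‖B 0‖ ≤ 2 * (|ξ| ^ (-(α / 2)) * Real.sqrt (Real.log |ξ|)) := by
    have c1 : ‖B 0‖ ≤ 1 / |ξ| := by
      simp only [hB, Av, St, cnt]
      simp only [pow_zero, div_one, Finset.sum_singleton, Nat.cast_zero, mul_zero, e_zero, mul_one,
        Finset.range_zero, Finset.filter_empty, Finset.card_empty, one_mul]
      exact sc_le_inv ξ hξ0
    have c2 : 1 / |ξ| ≤ |ξ| ^ (-(α / 2)) := by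
      rw [one_div, ← Real.rpow_neg_one]
      exact Real.rpow_le_rpow_of_exponent_le (by linarith) (by linarith)
    have c3 : 1 / 2 ≤ Real.sqrt (Real.log |ξ|) := by
      apply Real.le_sqrt_of_sq_le
      have := Real.log_le_log (by norm_num) hξ
      have := Real.log_two_gt_d9
      linarith
    have c4 : 0 < |ξ| ^ (-(α / 2)) := by positivity
    nlinarith
  change ‖B K‖ ≤ _
  rw [hsum]
  refine (norm_add_le _ _).trans ?_
  have hS := (norm_sum_le_of_le (Finset.range K) fun k _ => hstep k)
  rw [← Finset.mul_sum] at hS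
  have := hb |ξ| hξ K
  linarith

lemma regular (α : ℝ) (h0 : 0 < α) (h1 : α < 1) (ω : ℕ → Bool) (r : ℝ) (hr : 0 < r)
    (hr1 : r < 1 / 2) :
    let x := Phi G (frα α) ω
    1 / 4 * (2 * r) ^ α ≤ P.real (Phi G (frα α) ⁻¹' Set.Icc (x - r) (x + r)) ∧
      P.real (Phi G (frα α) ⁻¹' Set.Icc (x - r) (x + r)) ≤ 14 * (2 * r) ^ α := by
  intro x
  set fr := frα α with hfr
  obtain ⟨n, hn1, hn2⟩ := exists_nat_pow_near_of_lt_one hr (by linarith) (y := (1 / 2 : ℝ))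
    (by norm_num) (by norm_num)
  set k := n + 1 with hk
  have hn2' : r ≤ 2 * (1 / 2) ^ k := by rw [hk, pow_succ]; linarith
  obtain ⟨c1, c2⟩ := cnt_bound α h0 h1 k
  set m := X G fr ω k with hm
  have hx := Phi_mem G fr ω k
  have split : ∀ y : ℝ, y / 2 ^ k = y * (1 / 2) ^ k := fun y => by rw [one_div_pow]; ring
  rw [split, split] at hx
  have hd : (0 : ℝ) < (1 / 2) ^ k := by positivity
  set d : ℝ := (1 / 2) ^ k with hd'
  constructor
  · calc 1 / 4 * (2 * r) ^ α ≤ (1 / 4) ^ α * (2 * r) ^ α := by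
          gcongr
          calc (1 / 4 : ℝ) = (1 / 4) ^ (1 : ℝ) := (Real.rpow_one _).symm
            _ ≤ _ := Real.rpow_le_rpow_of_exponent_ge (by norm_num) (by norm_num) h1.le
      _ = (r / 2) ^ α := by
          rw [← Real.mul_rpow (by norm_num) (by positivity)]; congr 1; ring
      _ ≤ d ^ α := Real.rpow_le_rpow (by positivity) (by linarith) h0.le
      _ ≤ _ := c1
      _ = P.real {ω' | X G fr ω' k = m} := (P_fiber G fr k m (X_mem G fr ω k)).symm
      _ ≤ _ := by
          refine measureReal_mono ?_
          intro ω' hω'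
          have hx' := Phi_mem G fr ω' k
          have hω'' : X G fr ω' k = m := hω'
          rw [split, split, hω''] at hx'
          obtain ⟨u1, u2⟩ := hx
          obtain ⟨v1, v2⟩ := hx'
          constructor <;> simp only [x] <;> linarith
  · have hsub : Phi G fr ⁻¹' Set.Icc (x - r) (x + r) ⊆
        ⋃ a ∈ (Finset.Icc (m - 3) (m + 3)).filter (fun a => a ∈ St G fr k),
          {ω' | X G fr ω' k = a} := by
      intro ω' hω'
      have hx' := Phi_mem G fr ω' k
      rw [split, split] at hx'
      obtain ⟨u1, u2⟩ := hx
      obtain ⟨v1, v2⟩ := hx'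
      obtain ⟨w1, w2⟩ := hω'
      have t1 : (X G fr ω' k : ℝ) ≤ m + 3 := by
        refine le_of_mul_le_mul_right ?_ hd
        simp only [x] at w1 w2
        linarith
      have t2 : (m : ℝ) ≤ X G fr ω' k + 3 := by
        refine le_of_mul_le_mul_right ?_ hd
        simp only [x] at w1 w2
        linarith
      have t1' : X G fr ω' k ≤ m + 3 := by exact_mod_cast t1
      have t2' : m ≤ X G fr ω' k + 3 := by exact_mod_cast t2
      simp only [Set.mem_iUnion]
      refine ⟨X G fr ω' k, ?_, rfl⟩
      rw [Finset.mem_filter, Finset.mem_Icc]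
      exact ⟨⟨by omega, t1'⟩, X_mem G fr ω' k⟩
    refine (measureReal_mono hsub (measure_ne_top _ _)).trans ((measureReal_biUnion_finset_le _ _).trans ?_)
    have h7 : ∀ a ∈ (Finset.Icc (m - 3) (m + 3)).filter (fun a => a ∈ St G fr k),
        P.real {ω' | X G fr ω' k = a} ≤ 2 * d ^ α := by
      intro a ha
      rw [P_fiber G fr k a (Finset.mem_filter.1 ha).2]
      exact c2
    refine (Finset.sum_le_card_nsmul _ _ _ h7).trans ?_
    rw [nsmul_eq_mul]
    have hcard : (((Finset.Icc (m - 3) (m + 3)).filter (fun a => a ∈ St G fr k)).card : ℝ) ≤ 7 := by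
      have := Finset.card_filter_le (Finset.Icc (m - 3) (m + 3)) (fun a => a ∈ St G fr k)
      rw [Nat.card_Icc] at this
      have h8 : ((Finset.Icc (m - 3) (m + 3)).filter (fun a => a ∈ St G fr k)).card ≤ 7 := by omega
      exact_mod_cast h8
    have hdr : d ^ α ≤ (2 * r) ^ α := Real.rpow_le_rpow hd.le (by linarith) h0.le
    have hd0 : 0 ≤ d ^ α := by positivity
    nlinarith

end SalemAux
end

theorem salem_near_endpoint_decay_regularity (α : ℝ) (hα0 : 0 < α) (hα1 : α < 1) :
    ∃ (E : Set ℝ) (μ : Measure ℝ) (c C : ℝ),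
      IsCompact E ∧ IsProbabilityMeasure μ ∧ μ E = 1 ∧ 0 < c ∧ c ≤ C ∧
      (∀ ξ : ℝ, 2 ≤ |ξ| →
        ‖∫ x : ℝ, Complex.exp (-(2 * (Real.pi : ℂ) * Complex.I * (ξ : ℂ) * (x : ℂ))) ∂μ‖
          ≤ C * |ξ| ^ (-(α / 2)) * Real.sqrt (Real.log |ξ|)) ∧
      (∀ x ∈ E, ∀ r : ℝ, 0 < r → r < 1 / 2 →
        c * (2 * r) ^ α ≤ (μ (Set.Icc (x - r) (x + r))).toReal ∧
        (μ (Set.Icc (x - r) (x + r))).toReal ≤ C * (2 * r) ^ α) := by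
  classical
  have hex : ∀ k : ℕ, ∀ S : Finset ℕ, ∃ g : ℕ → Bool, S ⊆ Finset.range (2 ^ k) → ∀ ξ : ℝ,
      ‖∑ x ∈ S, (SalemAux.sg (g x) : ℂ) * SalemAux.e (ξ * (x / 2 ^ k))‖ ≤
      12 * (Real.sqrt S.card * Real.sqrt (k + 1)) := by
    intro k S
    by_cases h : S ⊆ Finset.range (2 ^ k)
    · obtain ⟨g, hg⟩ := SalemAux.expsum k S h
      exact ⟨g, fun _ => hg⟩
    · exact ⟨fun _ => true, fun h' => absurd h' h⟩
  choose G hG using hex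
  obtain ⟨C, hC, hF⟩ := SalemAux.fourier_bound G hG α hα0 hα1
  have hcont := SalemAux.Phi_cont G (SalemAux.frα α)
  have hcomp : IsCompact (Set.range (SalemAux.Phi G (SalemAux.frα α))) := isCompact_range hcont
  refine ⟨Set.range (SalemAux.Phi G (SalemAux.frα α)),
    SalemAux.P.map (SalemAux.Phi G (SalemAux.frα α)), 1 / 4, 14 + C, hcomp,
    Measure.isProbabilityMeasure_map hcont.measurable.aemeasurable, ?_, by norm_num, by linarith,
    ?_, ?_⟩
  · rw [Measure.map_apply hcont.measurable hcomp.measurableSet]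
    simp
  · intro ξ hξ
    rw [integral_map hcont.measurable.aemeasurable (by fun_prop)]
    have h1 : ∀ y : ℝ, Complex.exp (-(2 * (Real.pi : ℂ) * Complex.I * (ξ : ℂ) * (y : ℂ))) =
        SalemAux.e (ξ * y) := by
      intro y; unfold SalemAux.e; congr 1; push_cast; ring
    simp_rw [h1]
    refine (hF ξ hξ).trans ?_
    rw [mul_assoc]
    gcongr
    linarith
  · rintro x ⟨ω, rfl⟩ r hr hr1
    rw [Measure.map_apply hcont.measurable measurableSet_Icc]
    obtain ⟨h1, h2⟩ := SalemAux.regular G α hα0 hα1 ω r hr hr1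
    refine ⟨h1, h2.trans ?_⟩
    gcongr
    linarith
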